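/- Let G be a finite simple graph of order n, and let a, b, m, Δ be non-negative integers with b − Δ ≥ a ≥ 2, δ(G) ≥ b(b−Δ)/(a+Δ) + m, and n > (a+b)(a+b+2m−2)/(a+Δ). Let g, f be integer-valued functions on V(G) with a ≤ g(x) ≤ f(x) − Δ ≤ b − Δ for every vertex x. If for every pair of distinct non-adjacent vertices u, v of G we have d_G(u) + d_G(v) ≥ 2(b−Δ)n/(a+b), then G is a fractional (g,f,m)-deleted graph. -/

import Mathlib

open Classical Finset

/-- The fractional degree `d_G^h(x)` of a vertex: the sum of `h e` over all edges
(unordered pairs) containing `x`. -/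
noncomputable def fracDeg {V : Type*} [Fintype V] [DecidableEq V]
    (h : Sym2 V → ℝ) (x : V) : ℝ :=
  ∑ e ∈ Finset.univ.filter (fun e : Sym2 V => x ∈ e), h e

/-- `G` admits a fractional `(g,f)`-factor: a weighting `h : E(G) → [0,1]`
(extended by `0` off the edge set) with `g x ≤ d_G^h(x) ≤ f x` for every vertex. -/
def HasFracFactor {V : Type*} [Fintype V] [DecidableEq V]
    (G : SimpleGraph V) (g f : V → ℤ) : Prop :=
  ∃ h : Sym2 V → ℝ,
    (∀ e, 0 ≤ h e ∧ h e ≤ 1) ∧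
    (∀ e, e ∉ G.edgeSet → h e = 0) ∧
    (∀ x : V, (g x : ℝ) ≤ fracDeg h x ∧ fracDeg h x ≤ (f x : ℝ))

/-- `G` is a fractional `(g,f,m)`-deleted graph: after deleting any `m` edges,
the resulting graph admits a fractional `(g,f)`-factor. -/
def FracDeleted {V : Type*} [Fintype V] [DecidableEq V]
    (G : SimpleGraph V) (g f : V → ℤ) (m : ℕ) : Prop :=
  ∀ H : Finset (Sym2 V), ↑H ⊆ G.edgeSet → H.card = m →
    HasFracFactor (G.deleteEdges ↑H) g f

/-- `G` is a fractional `(g,f,n',m)`-critical deleted graph: after deleting any `n'`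
vertices, the resulting induced graph is a fractional `(g,f,m)`-deleted graph. -/
def FracCriticalDeleted {V : Type*} [Fintype V] [DecidableEq V]
    (G : SimpleGraph V) (g f : V → ℤ) (n' m : ℕ) : Prop :=
  ∀ U : Finset V, U.card = n' →
    FracDeleted (G.induce ((↑U : Set V)ᶜ)) (fun x => g x.1) (fun x => f x.1) m

/-- `G` is a fractional ID-`(g,f,m)`-deleted graph: after deleting any independent set
of vertices, the resulting induced graph is a fractional `(g,f,m)`-deleted graph. -/
def FracIDDeleted {V : Type*} [Fintype V] [DecidableEq V]
    (G : SimpleGraph V) (g f : V → ℤ) (m : ℕ) : Prop :=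
  ∀ I : Set V, (∀ u ∈ I, ∀ v ∈ I, ¬ G.Adj u v) →
    FracDeleted (G.induce Iᶜ) (fun x => g x.1) (fun x => f x.1) m

/-- On a finite graph, the degree of `x` under a symmetric weighting is the sum over the other
endpoint. -/
theorem fracDeg_eq_sum {V : Type*} [Fintype V] [DecidableEq V] (h : Sym2 V → ℝ) (x : V) :
    fracDeg h x = ∑ y, h s(x, y) := by
  have himage : (Finset.univ.filter fun e : Sym2 V => x ∈ e) =
      Finset.univ.image fun y => s(x, y) := by
    ext e
    simp [Sym2.mem_iff_exists, eq_comm]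
  rw [fracDeg, himage, Finset.sum_image]
  intro y _ z _ hyz
  exact Sym2.congr_right.1 hyz

theorem integral_indicator_Ioc (p q : ℝ) :
    ∫ t, (Set.Ioc p q).indicator (fun _ => (1 : ℝ)) t = max (q - p) 0 := by
  rw [MeasureTheory.integral_indicator measurableSet_Ioc]
  simp

theorem integrable_indicator_Ioc (p q : ℝ) :
    MeasureTheory.Integrable ((Set.Ioc p q).indicator fun _ => (1 : ℝ)) := by
  rw [MeasureTheory.integrable_indicator_iff measurableSet_Ioc]
  exact MeasureTheory.integrableOn_const (by simp)

theorem max_sub_add_max_sub (u v : ℝ) :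
    max (u - max 0 (-v)) 0 + max (v - max 0 (-u)) 0 = max (u + v) 0 := by
  rcases le_total 0 u with hu | hu <;> rcases le_total 0 v with hv | hv <;>
    rcases le_total 0 (u + v) with huv | huv <;>
    simp only [max_def] <;> split_ifs <;> linarith

/-- The dual inequality of the fractional `(g,f)`-factor problem, obtained by integrating the cut
condition over the level sets of `w`. -/
theorem dual_inequality_of_cut_condition {V : Type*} [Fintype V] [DecidableEq V]
    (G : SimpleGraph V) [DecidableRel G.Adj] (g f : V → ℤ)
    (hcut : ∀ S T : Finset V, Disjoint S T →
      ∑ x ∈ T, g x ≤ ∑ x ∈ S, f x + ∑ x ∈ T, (#{y | G.Adj x y ∧ y ∉ S} : ℤ))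
    (w : V → ℝ) :
    ∑ x, (g x * max (w x) 0 - f x * max (-w x) 0) ≤
      ∑ x, ∑ y, if G.Adj x y then max (w x + w y) 0 / 2 else 0 := by
  let I : ℝ → ℝ → ℝ → ℝ := fun p q => (Set.Ioc p q).indicator fun _ => (1 : ℝ)
  have hI : ∀ p q, MeasureTheory.Integrable (I p q) := integrable_indicator_Ioc
  have hIval : ∀ p q, ∫ t, I p q t = max (q - p) 0 := integral_indicator_Ioc
  have hpoint : ∀ t, ∑ x, (g x * I 0 (w x) t - f x * I 0 (-w x) t) ≤
      ∑ x, ∑ y, (if G.Adj x y then 1 else 0) * I (max 0 (-w y)) (w x) t := by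
    intro t
    by_cases ht : 0 < t
    · let S : Finset V := Finset.univ.filter fun x => t ≤ -w x
      let T : Finset V := Finset.univ.filter fun x => t ≤ w x
      have hST : Disjoint S T := by
        rw [Finset.disjoint_left]
        intro x hxS hxT
        simp only [S, T, Finset.mem_filter, Finset.mem_univ, true_and] at hxS hxT
        linarith
      have hc : (∑ x ∈ T, (g x : ℝ)) ≤
          ∑ x ∈ S, (f x : ℝ) + ∑ x ∈ T, (#{y | G.Adj x y ∧ y ∉ S} : ℝ) := by
        exact_mod_cast hcut S T hST
      have h1 : ∑ x, g x * I 0 (w x) t = ∑ x ∈ T, (g x : ℝ) := by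
        rw [Finset.sum_filter]
        refine Finset.sum_congr rfl fun x _ => ?_
        by_cases h : t ≤ w x <;> simp [I, ht, h]
      have h2 : ∑ x, f x * I 0 (-w x) t = ∑ x ∈ S, (f x : ℝ) := by
        rw [Finset.sum_filter]
        refine Finset.sum_congr rfl fun x _ => ?_
        by_cases h : t ≤ -w x <;> simp [I, ht, h]
      have h3 : ∑ x, ∑ y, (if G.Adj x y then 1 else 0) * I (max 0 (-w y)) (w x) t =
          ∑ x ∈ T, (#{y | G.Adj x y ∧ y ∉ S} : ℝ) := by
        rw [Finset.sum_filter]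
        refine Finset.sum_congr rfl fun x _ => ?_
        by_cases h : t ≤ w x
        · rw [if_pos h, Finset.card_filter]
          push_cast
          refine Finset.sum_congr rfl fun y _ => ?_
          by_cases hxy : G.Adj x y <;> simp [I, Set.indicator, ht, h, hxy, S]
        · rw [if_neg h]
          exact Finset.sum_eq_zero fun y _ => by simp [I, h]
      rw [Finset.sum_sub_distrib, h1, h2, h3]
      linarith
    · have hz : ∀ p q, 0 ≤ p → I p q t = 0 := fun p q hp =>
        Set.indicator_of_notMem (fun h => ht (hp.trans_lt h.1)) _
      simp [hz]
  have hint1 : ∀ x ∈ Finset.univ, MeasureTheory.Integrable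
      fun t => (g x : ℝ) * I 0 (w x) t - f x * I 0 (-w x) t := fun x _ =>
    ((hI _ _).const_mul _).sub ((hI _ _).const_mul _)
  have hint2 : ∀ x y : V, MeasureTheory.Integrable
      fun t => (if G.Adj x y then (1 : ℝ) else 0) * I (max 0 (-w y)) (w x) t := fun x y =>
    (hI _ _).const_mul _
  have hmono := MeasureTheory.integral_mono
    (MeasureTheory.integrable_finsetSum _ hint1)
    (MeasureTheory.integrable_finsetSum _ fun x _ =>
      MeasureTheory.integrable_finsetSum _ fun y _ => hint2 x y) hpoint
  rw [MeasureTheory.integral_finsetSum _ hint1, MeasureTheory.integral_finsetSum _ fun x _ =>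
      MeasureTheory.integrable_finsetSum _ fun y _ => hint2 x y] at hmono
  have hleft : ∀ x, ∫ t, ((g x : ℝ) * I 0 (w x) t - f x * I 0 (-w x) t) =
      g x * max (w x) 0 - f x * max (-w x) 0 := by
    intro x
    rw [MeasureTheory.integral_sub ((hI _ _).const_mul _) ((hI _ _).const_mul _),
      MeasureTheory.integral_const_mul, MeasureTheory.integral_const_mul, hIval, hIval,
      sub_zero, sub_zero]
  have hright : ∀ x, ∫ t, ∑ y, (if G.Adj x y then (1 : ℝ) else 0) * I (max 0 (-w y)) (w x) t =
      ∑ y, (if G.Adj x y then (1 : ℝ) else 0) * max (w x - max 0 (-w y)) 0 := by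
    intro x
    rw [MeasureTheory.integral_finsetSum _ fun y _ => hint2 x y]
    simp only [MeasureTheory.integral_const_mul, hIval]
  simp only [hleft, hright] at hmono
  refine hmono.trans_eq ?_
  have hswap := Finset.sum_comm (s := Finset.univ) (t := Finset.univ) (f := fun x y : V =>
    (if G.Adj x y then (1 : ℝ) else 0) * max (w x - max 0 (-w y)) 0)
  have hsum : ∑ x, ∑ y, (if G.Adj x y then max (w x + w y) 0 / 2 else 0) =
      (∑ x, ∑ y, (if G.Adj x y then (1 : ℝ) else 0) * max (w x - max 0 (-w y)) 0 +
      ∑ x, ∑ y, (if G.Adj y x then (1 : ℝ) else 0) * max (w y - max 0 (-w x)) 0) / 2 := by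
    simp only [← Finset.sum_add_distrib, Finset.sum_div]
    refine Finset.sum_congr rfl fun x _ => Finset.sum_congr rfl fun y _ => ?_
    by_cases hxy : G.Adj x y
    · simp [hxy, hxy.symm, ← max_sub_add_max_sub (w x) (w y)]
    · simp [hxy, G.adj_comm y x]
  rw [hsum, ← hswap]
  ring

/-- Anstee's criterion (sufficiency): the cut condition yields a fractional `(g,f)`-factor. -/
theorem hasFracFactor_of_cut_condition {V : Type*} [Fintype V] [DecidableEq V]
    (G : SimpleGraph V) [DecidableRel G.Adj] (g f : V → ℤ) (hgf : ∀ x, g x ≤ f x)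
    (hcut : ∀ S T : Finset V, Disjoint S T →
      ∑ x ∈ T, g x ≤ ∑ x ∈ S, f x + ∑ x ∈ T, (#{y | G.Adj x y ∧ y ∉ S} : ℤ)) :
    HasFracFactor G g f := by
  let U : V → V → ℝ := fun x y => if G.Adj x y then 1 else 0
  let C : Set (V → V → ℝ) := Set.Icc 0 U
  let D : (V → V → ℝ) →ₗ[ℝ] (V → ℝ) :=
    { toFun := fun φ x => ∑ y, (φ x y + φ y x) / 2
      map_add' := fun φ ψ => by
        ext x
        simp only [Pi.add_apply, ← Finset.sum_add_distrib]
        exact Finset.sum_congr rfl fun y _ => by ring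
      map_smul' := fun c φ => by
        ext x
        simp only [Pi.smul_apply, smul_eq_mul, RingHom.id_apply, Finset.mul_sum]
        exact Finset.sum_congr rfl fun y _ => by ring }
  let box : Set (V → ℝ) := Set.Icc (fun x => (g x : ℝ)) (fun x => (f x : ℝ))
  by_cases hdisj : Disjoint (D '' C) box
  · exfalso
    obtain ⟨L, u, v, hLu, huv, hLv⟩ := geometric_hahn_banach_compact_closed
      ((convex_Icc (𝕜 := ℝ) (0 : V → V → ℝ) U).linear_image D)
      (isCompact_Icc.image D.continuous_of_finiteDimensional)
      (convex_Icc (𝕜 := ℝ) (fun x => (g x : ℝ)) (fun x => (f x : ℝ))) isClosed_Icc hdisj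
    let w : V → ℝ := fun x => L (Pi.single x 1)
    have hL : ∀ z : V → ℝ, L z = ∑ x, z x * w x := by
      intro z
      conv_lhs => rw [pi_eq_sum_univ' z]
      simp [w, map_sum, Pi.single]
    let φ : V → V → ℝ := fun x y => if G.Adj x y ∧ 0 < w x + w y then 1 else 0
    have hφ : φ ∈ C := by
      constructor
      · intro x y
        simp only [φ, Pi.zero_apply]
        split_ifs <;> norm_num
      · intro x y
        by_cases h : G.Adj x y <;> simp only [φ, U, h, true_and, false_and, if_true, if_false]
        · split_ifs <;> norm_num
        · exact le_rfl
    let z : V → ℝ := fun x => if 0 ≤ w x then g x else f x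
    have hgf' : ∀ x, (g x : ℝ) ≤ f x := fun x => by exact_mod_cast hgf x
    have hz : z ∈ box := by
      constructor <;> intro x <;> simp only [z] <;> split_ifs <;> simp [hgf' x]
    have hlt : L (D φ) < L z := (hLu _ ⟨φ, hφ, rfl⟩).trans (huv.trans (hLv _ hz))
    have hLz : L z = ∑ x, (g x * max (w x) 0 - f x * max (-w x) 0) := by
      rw [hL]
      refine Finset.sum_congr rfl fun x _ => ?_
      by_cases h : 0 ≤ w x
      · simp [z, h]
      · have h' : w x ≤ 0 := (not_le.1 h).le
        simp [z, h, h']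
    have hLφ : L (D φ) = ∑ x, ∑ y, if G.Adj x y then max (w x + w y) 0 / 2 else 0 := by
      have hsymm : ∀ x y, φ y x = φ x y := fun x y => by
        simp only [φ, G.adj_comm y x, add_comm (w y) (w x)]
      have hD : ∀ x, D φ x = ∑ y, φ x y := fun x =>
        Finset.sum_congr rfl fun y _ => by rw [hsymm x y]; ring
      have h1 : L (D φ) = ∑ x, ∑ y, φ x y * w x := by
        simp only [hL, hD, Finset.sum_mul]
      have h2 : L (D φ) = ∑ x, ∑ y, φ x y * w y := by
        rw [h1, Finset.sum_comm]
        simp only [hsymm]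
      have h3 : L (D φ) = (∑ x, ∑ y, φ x y * w x + ∑ x, ∑ y, φ x y * w y) / 2 := by
        rw [← h1, ← h2]
        ring
      rw [h3]
      simp only [← Finset.sum_add_distrib, Finset.sum_div]
      refine Finset.sum_congr rfl fun x _ => Finset.sum_congr rfl fun y _ => ?_
      by_cases hxy : G.Adj x y
      · by_cases hw : 0 < w x + w y
        · simp [φ, hxy, hw, hw.le]
        · simp [φ, hxy, hw, not_lt.1 hw]
      · simp [φ, hxy]
    have := dual_inequality_of_cut_condition G g f hcut w
    linarith
  · rw [Set.not_disjoint_iff] at hdisj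
    obtain ⟨_, ⟨φ, ⟨hφ0, hφU⟩, rfl⟩, hlo, hhi⟩ := hdisj
    let h : Sym2 V → ℝ := Sym2.lift ⟨fun x y => (φ x y + φ y x) / 2, fun x y => by ring⟩
    have hnonneg : ∀ x y, 0 ≤ φ x y := hφ0
    have hle : ∀ x y, φ x y ≤ U x y := hφU
    have hU : ∀ x y, U x y ≤ 1 := fun x y => by
      simp only [U]
      split_ifs <;> norm_num
    refine ⟨h, ?_, ?_, ?_⟩
    · intro e
      induction e with
      | _ x y =>
        simp only [h, Sym2.lift_mk]
        constructor <;> linarith [hnonneg x y, hnonneg y x, hle x y, hle y x, hU x y, hU y x]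
    · intro e
      induction e with
      | _ x y =>
        intro hxy
        rw [SimpleGraph.mem_edgeSet] at hxy
        have h1 := hle x y
        have h2 := hle y x
        simp only [U, hxy, G.adj_comm y x, if_false] at h1 h2
        simp only [h, Sym2.lift_mk]
        linarith [hnonneg x y, hnonneg y x]
    · intro x
      have hdeg : fracDeg h x = D φ x := by
        rw [fracDeg_eq_sum]
        rfl
      rw [hdeg]
      exact ⟨hlo x, hhi x⟩

theorem degree_le_card_filter_add_card {V : Type*} [Fintype V] [DecidableEq V]
    (G : SimpleGraph V) [DecidableRel G.Adj] (S : Finset V) (x : V) :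
    G.degree x ≤ #{y | G.Adj x y ∧ y ∉ S} + #S := by
  rw [← G.card_neighborFinset_eq_degree]
  refine (Finset.card_le_card fun y hy => ?_).trans (Finset.card_union_le _ _)
  rw [SimpleGraph.mem_neighborFinset] at hy
  by_cases hyS : y ∈ S <;> simp [hy, hyS]

theorem card_filter_le_deleteEdges {V : Type*} [Fintype V] [DecidableEq V]
    (G : SimpleGraph V) [DecidableRel G.Adj] (H : Finset (Sym2 V)) (S : Finset V)
    (x : V) :
    #{y | G.Adj x y ∧ y ∉ S} ≤
      #{y | (G.deleteEdges (H : Set (Sym2 V))).Adj x y ∧ y ∉ S} + #{e ∈ H | x ∈ e} := by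
  have hsub : ({y | G.Adj x y ∧ y ∉ S} : Finset V) ⊆
      ({y | (G.deleteEdges (H : Set (Sym2 V))).Adj x y ∧ y ∉ S} : Finset V) ∪
        ({y | s(x, y) ∈ H} : Finset V) := by
    intro y hy
    by_cases hyH : s(x, y) ∈ H <;> simp_all
  have hle : #{y | s(x, y) ∈ H} ≤ #{e ∈ H | x ∈ e} :=
    Finset.card_le_card_of_injOn (fun y => s(x, y)) (fun y hy => by simp_all)
      fun y _ z _ hyz => Sym2.congr_right.1 hyz
  exact (Finset.card_le_card hsub).trans ((Finset.card_union_le _ _).trans (by omega))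

theorem sum_card_incident_le {V : Type*} [DecidableEq V] (H : Finset (Sym2 V)) (T : Finset V) :
    ∑ x ∈ T, #{e ∈ H | x ∈ e} ≤ 2 * #H := by
  have hswap : ∑ x ∈ T, #{e ∈ H | x ∈ e} = ∑ e ∈ H, #{x ∈ T | x ∈ e} := by
    simp only [Finset.card_filter]
    exact Finset.sum_comm
  rw [hswap, mul_comm, ← smul_eq_mul]
  refine Finset.sum_le_card_nsmul _ _ _ fun e _ => ?_
  induction e with
  | _ u v =>
    refine (Finset.card_le_card (t := {u, v}) fun x hx => ?_).trans Finset.card_le_two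
    simp_all

/-- If few vertices lie in `T`, the minimum degree alone excludes a violated cut. -/
theorem lt_card_of_violated {α b B s t D : ℝ} (hα : 0 < α) (hαb : α ≤ b) (hB : 0 ≤ B)
    (hs : 0 ≤ s) (ht : 0 ≤ t) (hD : 0 ≤ D) (hviol : α * s + D + 1 ≤ B * t)
    (hdeg : t * (b * B - α * s) ≤ α * D) : b < t := by
  by_contra! htb
  rcases le_total (b * B) (α * s) with h | h
  · nlinarith
  · have h1 : α * (α * s + D + 1) ≤ α * (B * t) := mul_le_mul_of_nonneg_left hviol hα.le
    rcases le_total α t with h2 | h2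
    · nlinarith [mul_nonneg (sub_nonneg.2 h) (sub_nonneg.2 h2),
        mul_nonneg (mul_nonneg hα.le hB) (sub_nonneg.2 htb)]
    · nlinarith [mul_nonneg (mul_nonneg hα.le hs) (sub_nonneg.2 h2),
        mul_nonneg (mul_nonneg hB ht) (sub_nonneg.2 hαb)]

/-- No cut is violated when every vertex of `T` keeps at least `B` neighbours. -/
theorem not_violated_of_large_degrees {α b B s t D m : ℝ} (hα : 2 ≤ α) (hαb : α ≤ b)
    (hB : 0 ≤ B) (hm : 0 ≤ m) (hbt : b < t)
    (hviol : α * s + D + 1 ≤ B * t) (hlarge : B * t - 2 * m ≤ D)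
    (hdeg : t * (b * B + α * m - α * s) ≤ α * (D + 2 * m)) : False := by
  have h1 : α * s + 1 ≤ 2 * m := by linarith
  have h2 : s ≤ m := by
    by_contra! h
    nlinarith
  have h3 : 0 ≤ b * B - α * B + α * (m - s) := by nlinarith
  have h4 : α * (α * s + D + 1) ≤ α * (B * t) :=
    mul_le_mul_of_nonneg_left hviol (by linarith)
  have h5 : 0 ≤ (t - α) * (b * B - α * B + α * (m - s)) := mul_nonneg (by linarith) h3
  have h6 : α * (α * s + (b * B - α * B + α * (m - s)) - 2 * m + 1) ≤ 0 := by nlinarith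
  have h7 : 0 < α * s + (b * B - α * B + α * (m - s)) - 2 * m + 1 := by nlinarith
  nlinarith

/-- No cut is violated when the non-neighbour `x₂` of `x₁` has residual degree at most `B`. -/
theorem not_violated_of_small_second_degree {α B s t D m n p : ℝ} {d₁ d₂ : ℕ} (hα : 2 ≤ α)
    (hB : 2 ≤ B) (hm : 0 ≤ m) (hD : 0 ≤ D) (h12 : d₁ ≤ d₂) (h2B : (d₂ : ℝ) ≤ B)
    (hp : p ≤ d₁ + 1) (hst : s + t ≤ n)
    (hviol : α * s + D + 1 ≤ B * t) (hlow : d₁ * p + d₂ * (t - p) ≤ D + 2 * m)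
    (hn : (α + B) * (α + B + 2 * m - 2) < α * n)
    (hσ : 2 * B * n ≤ (α + B) * (2 * s + d₁ + d₂)) : False := by
  have h12' : (d₁ : ℝ) ≤ d₂ := by exact_mod_cast h12
  rcases Nat.eq_zero_or_pos d₂ with h0 | hpos
  · have h0' : d₁ = 0 := by omega
    subst h0 h0'
    push_cast at *
    nlinarith
  · have hpos' : (1 : ℝ) ≤ d₂ := by exact_mod_cast hpos
    have h1 : (α + B - d₂) * s + 1 ≤ (B - d₂) * n + (d₂ - d₁) * (d₁ + 1) + 2 * m := by
      nlinarith [mul_nonneg (sub_nonneg.2 h2B) (sub_nonneg.2 hst),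
        mul_nonneg (sub_nonneg.2 h12') (sub_nonneg.2 hp)]
    have h2 : 0 ≤ (α + B - d₂) * ((α + B) * (2 * s + d₁ + d₂) - 2 * B * n) :=
      mul_nonneg (by linarith) (by linarith)
    have h3 : 2 * d₂ * ((α + B) * (α + B + 2 * m - 2)) < 2 * d₂ * (α * n) :=
      mul_lt_mul_of_pos_left hn (by linarith)
    have h4 : (α + B) * (2 * d₂ * (α + B + 2 * m - 2) + 2) <
        (α + B) * ((α + B - d₂) * (d₁ + d₂) + 2 * (d₂ - d₁) * (d₁ + 1) + 4 * m) := by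
      nlinarith [mul_le_mul_of_nonneg_left h1 (by linarith : (0 : ℝ) ≤ 2 * (α + B))]
    have h5 := lt_of_mul_lt_mul_left h4 (by linarith)
    have h6 : 0 ≤ m * (d₂ - 1) := mul_nonneg hm (by linarith)
    have h7 : 0 ≤ (α + B - d₂ - 2) * (d₂ - d₁) := mul_nonneg (by linarith) (by linarith)
    rcases Nat.lt_or_ge d₂ 2 with hlt | hge
    · have h1' : d₂ = 1 := by omega
      subst h1'
      interval_cases d₁ <;> push_cast at * <;> nlinarith
    · have hge' : (2 : ℝ) ≤ d₂ := by exact_mod_cast hge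
      nlinarith [sq_nonneg ((d₂ : ℝ) / 2 - d₁)]

/-- No cut is violated when the non-neighbour `x₂` of `x₁` has residual degree at least `B`:
then the `q` non-neighbours of `x₁` in `T` all lose many edges. -/
theorem not_violated_of_large_second_degree {a Δ B s m n q d₁ d₂ : ℝ} (ha : 2 ≤ a)
    (hΔ : 0 ≤ Δ) (haB : a ≤ B) (hm : 0 ≤ m) (h1B : d₁ + 1 ≤ B) (hB2 : B ≤ d₂)
    (hq : Δ + 1 ≤ q) (hloss : q * (d₂ + 1 - B) ≤ 2 * m)
    (hviol : (a + Δ) * s + 1 ≤ (B - d₁) * (d₁ + 1) + 2 * m)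
    (hn : (a + Δ + B) * (a + Δ + B + 2 * m - 2) < (a + Δ) * n)
    (hσ : 2 * B * n ≤ (a + Δ + B) * (2 * s + d₁ + d₂)) : False := by
  have h1 : 2 * B * ((a + Δ + B) * (a + Δ + B + 2 * m - 2)) < 2 * B * ((a + Δ) * n) :=
    mul_lt_mul_of_pos_left hn (by linarith)
  have h2 : (a + Δ) * (2 * B * n) ≤ (a + Δ) * ((a + Δ + B) * (2 * s + d₁ + d₂)) :=
    mul_le_mul_of_nonneg_left hσ (by linarith)
  have h3 : (a + Δ + B) * (2 * B * (a + Δ + B + 2 * m - 2)) <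
      (a + Δ + B) * ((a + Δ) * (2 * s + d₁ + d₂)) := by linarith
  have h4 := lt_of_mul_lt_mul_left h3 (by linarith)
  have h5 : (Δ + 1) * (d₂ + 1 - B) ≤ 2 * m :=
    (mul_le_mul_of_nonneg_right hq (by linarith)).trans hloss
  have h6 : (a + Δ) * (d₂ + 1 - B) ≤ 2 * B * m := by
    have h7 : (a + Δ) * (d₂ + 1 - B) ≤ a * (Δ + 1) * (d₂ + 1 - B) :=
      mul_le_mul_of_nonneg_right (by nlinarith) (by linarith)
    have h8 : a * ((Δ + 1) * (d₂ + 1 - B)) ≤ a * (2 * m) :=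
      mul_le_mul_of_nonneg_left h5 (by linarith)
    nlinarith
  have h9 : 0 ≤ (B - 2) * m := mul_nonneg (by linarith) hm
  have h10 : 0 ≤ (a + Δ - 2) * (B - d₁ + 1) := mul_nonneg (by linarith) (by linarith)
  nlinarith [sq_nonneg (B / 2 - d₁), sq_nonneg (B - 4 / 3)]

theorem statement_15 {V : Type*} [Fintype V] [DecidableEq V]
    (G : SimpleGraph V) [DecidableRel G.Adj] (a b m Δ : ℕ) (g f : V → ℤ)
    (hba : a + Δ ≤ b) (ha : 2 ≤ a)
    (hmin : ∀ v : V, (G.degree v : ℝ) ≥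
      (b : ℝ) * ((b : ℝ) - Δ) / ((a : ℝ) + Δ) + m)
    (hn : (Fintype.card V : ℝ) >
      ((a : ℝ) + b) * ((a : ℝ) + b + 2 * m - 2) / ((a : ℝ) + Δ))
    (hgf : ∀ x : V, (a : ℤ) ≤ g x ∧ g x ≤ f x - (Δ : ℤ) ∧ f x - (Δ : ℤ) ≤ (b : ℤ) - (Δ : ℤ))
    (hdeg : ∀ u v : V, u ≠ v → ¬ G.Adj u v →
      ((G.degree u : ℝ) + (G.degree v : ℝ)) ≥
        2 * ((b : ℝ) - Δ) * Fintype.card V / ((a : ℝ) + b)) :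
    FracDeleted G g f m := by
  intro H _ hHm
  refine hasFracFactor_of_cut_condition _ g f (fun x => by have := hgf x; omega) ?_
  by_contra! hfail
  obtain ⟨S, T₀, hST₀, hT₀⟩ := hfail
  set d' : V → ℕ := fun x => #{y | (G.deleteEdges (H : Set (Sym2 V))).Adj x y ∧ y ∉ S}
  set d : V → ℕ := fun x => #{y | G.Adj x y ∧ y ∉ S}
  set l : V → ℕ := fun x => #{e ∈ H | x ∈ e}
  have hdl : ∀ x, d x ≤ d' x + l x := card_filter_le_deleteEdges G H S
  have hds : ∀ x, G.degree x ≤ d x + #S := degree_le_card_filter_add_card G S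
  have hlm : ∀ x, l x ≤ m := fun x => hHm ▸ Finset.card_filter_le _ _
  -- Shrink `T₀` to the vertices whose demand is not met by their residual degree.
  set T : Finset V := T₀.filter fun x => (d' x : ℤ) < g x with hTdef
  have hviolZ : ∑ x ∈ S, f x + ∑ x ∈ T, (d' x : ℤ) < ∑ x ∈ T, g x := by
    have h1 : ∑ x ∈ T₀, (g x - d' x) ≤ ∑ x ∈ T, (g x - d' x) := by
      rw [hTdef, Finset.sum_filter]
      refine Finset.sum_le_sum fun x _ => ?_
      split_ifs <;> omega
    rw [Finset.sum_sub_distrib, Finset.sum_sub_distrib] at h1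
    linarith
  have hTd' : ∀ x ∈ T, (d' x : ℤ) + 1 ≤ b - Δ := fun x hx => by
    have := (Finset.mem_filter.1 hx).2
    have := hgf x
    omega
  have hviol : ((a : ℝ) + Δ) * #S + ∑ x ∈ T, (d' x : ℝ) + 1 ≤ ((b : ℝ) - Δ) * #T := by
    have hS : (#S : ℤ) * (a + Δ) ≤ ∑ x ∈ S, f x := by
      rw [← nsmul_eq_mul]
      exact Finset.card_nsmul_le_sum _ _ _ fun x _ => by have := hgf x; omega
    have hT : ∑ x ∈ T, g x ≤ (#T : ℤ) * (b - Δ) := by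
      rw [← nsmul_eq_mul]
      exact Finset.sum_le_card_nsmul _ _ _ fun x _ => by have := hgf x; omega
    have hZ : ((a : ℤ) + Δ) * #S + ∑ x ∈ T, (d' x : ℤ) + 1 ≤ ((b : ℤ) - Δ) * #T := by linarith
    exact_mod_cast hZ
  have hcard : (#S : ℝ) + #T ≤ Fintype.card V := by
    have hdisj : Disjoint S T :=
      Finset.disjoint_of_subset_right (Finset.filter_subset _ _) hST₀
    have := Finset.card_le_univ (S ∪ T)
    rw [Finset.card_union_of_disjoint hdisj] at this
    exact_mod_cast this
  have hloss : ∑ x ∈ T, (l x : ℝ) ≤ 2 * m := by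
    have := sum_card_incident_le H T
    rw [hHm] at this
    exact_mod_cast this
  have hdlR : ∀ x, (d x : ℝ) ≤ d' x + l x := fun x => by exact_mod_cast hdl x
  have hdsR : ∀ x, (G.degree x : ℝ) ≤ d x + #S := fun x => by exact_mod_cast hds x
  have hlmR : ∀ x, (l x : ℝ) ≤ m := fun x => by exact_mod_cast hlm x
  have hsumd : ∑ x ∈ T, (d x : ℝ) ≤ ∑ x ∈ T, (d' x : ℝ) + 2 * m := by
    have := Finset.sum_le_sum fun x (_ : x ∈ T) => hdlR x
    rw [Finset.sum_add_distrib] at this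
    linarith
  have haR : (2 : ℝ) ≤ a := by exact_mod_cast ha
  have hΔR : (0 : ℝ) ≤ Δ := Nat.cast_nonneg _
  have hmR : (0 : ℝ) ≤ m := Nat.cast_nonneg _
  have hbaR : (a : ℝ) + Δ ≤ b := by exact_mod_cast hba
  have hα : (0 : ℝ) < a + Δ := by linarith
  have hminR : ∀ x, (b : ℝ) * (b - Δ) + (a + Δ) * m ≤ (a + Δ) * G.degree x := fun x => by
    have h := mul_le_mul_of_nonneg_left (hmin x) hα.le
    rwa [mul_add, mul_div_cancel₀ _ hα.ne'] at h
  have hD : (0 : ℝ) ≤ ∑ x ∈ T, (d' x : ℝ) := Finset.sum_nonneg fun _ _ => Nat.cast_nonneg _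
  have hbT : (b : ℝ) < #T := by
    refine lt_card_of_violated hα hbaR (by linarith) (Nat.cast_nonneg _) (Nat.cast_nonneg _) hD
      hviol ?_
    rw [← nsmul_eq_mul, Finset.mul_sum]
    refine Finset.card_nsmul_le_sum _ _ _ fun x _ => ?_
    have h1 : (G.degree x : ℝ) ≤ d' x + m + #S := by linarith [hdsR x, hdlR x, hlmR x]
    have h2 := mul_le_mul_of_nonneg_left h1 hα.le
    linarith [hminR x]
  have hTne : T.Nonempty := Finset.card_pos.1 (by
    have : (0 : ℝ) < #T := by linarith
    exact_mod_cast this)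
  obtain ⟨x₁, hx₁T, hx₁⟩ := T.exists_min_image d hTne
  by_cases hlarge : (b : ℝ) - Δ ≤ d x₁
  · refine not_violated_of_large_degrees (m := m) (by linarith) hbaR (by linarith) hmR hbT hviol
      ?_ ?_
    · have h : (#T : ℝ) * (b - Δ) ≤ ∑ x ∈ T, (d x : ℝ) := by
        rw [← nsmul_eq_mul]
        refine Finset.card_nsmul_le_sum _ _ _ fun x hx => hlarge.trans ?_
        exact_mod_cast hx₁ x hx
      linarith
    · refine le_trans ?_ (mul_le_mul_of_nonneg_left hsumd hα.le)
      rw [← nsmul_eq_mul, Finset.mul_sum]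
      refine Finset.card_nsmul_le_sum _ _ _ fun x _ => ?_
      have h2 := mul_le_mul_of_nonneg_left (hdsR x) hα.le
      linarith [hminR x]
  · have hsmall : (d x₁ : ℝ) + 1 ≤ b - Δ := by
      have h1 : (d x₁ : ℝ) + Δ < b := by linarith
      have h2 : d x₁ + Δ + 1 ≤ b := by exact_mod_cast h1
      have h3 : (d x₁ : ℝ) + Δ + 1 ≤ b := by exact_mod_cast h2
      linarith
    set N : Finset V := T.filter fun x => x = x₁ ∨ G.Adj x₁ x
    set Q : Finset V := T.filter fun x => ¬ (x = x₁ ∨ G.Adj x₁ x)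
    have hNQ : (#N : ℝ) + #Q = #T := by
      exact_mod_cast Finset.card_filter_add_card_filter_not (s := T) fun x => x = x₁ ∨ G.Adj x₁ x
    have hNcard : (#N : ℝ) ≤ d x₁ + 1 := by
      have hsub : N ⊆ insert x₁ ({y | G.Adj x₁ y ∧ y ∉ S} : Finset V) := by
        intro y hy
        obtain ⟨hyT, hy⟩ := Finset.mem_filter.1 hy
        have hyS : y ∉ S := fun h =>
          Finset.disjoint_left.1 hST₀ h (Finset.mem_filter.1 hyT).1
        rcases hy with rfl | hy
        · simp
        · simp [hy, hyS]
      exact_mod_cast (Finset.card_le_card hsub).trans (Finset.card_insert_le _ _)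
    have hQne : Q.Nonempty := Finset.card_pos.1 (by
      have : (0 : ℝ) < #Q := by linarith
      exact_mod_cast this)
    obtain ⟨x₂, hx₂Q, hx₂⟩ := Q.exists_min_image d hQne
    obtain ⟨hx₂T, hx₂n⟩ := Finset.mem_filter.1 hx₂Q
    have h12 : d x₁ ≤ d x₂ := hx₁ x₂ hx₂T
    have hsplit : (d x₁ : ℝ) * #N + d x₂ * #Q ≤ ∑ x ∈ T, (d x : ℝ) := by
      rw [← Finset.sum_filter_add_sum_filter_not T fun x => x = x₁ ∨ G.Adj x₁ x,
        mul_comm, mul_comm (d x₂ : ℝ), ← nsmul_eq_mul, ← nsmul_eq_mul]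
      refine add_le_add (Finset.card_nsmul_le_sum _ _ _ fun x hx => ?_)
        (Finset.card_nsmul_le_sum _ _ _ fun x hx => ?_)
      · exact_mod_cast hx₁ x (Finset.mem_filter.1 hx).1
      · exact_mod_cast hx₂ x hx
    have hnR : ((a : ℝ) + Δ + (b - Δ)) * (a + Δ + (b - Δ) + 2 * m - 2) <
        (a + Δ) * Fintype.card V := by
      have h := (div_lt_iff₀ hα).1 hn
      have hab : (a : ℝ) + Δ + (b - Δ) = a + b := by ring
      rw [hab]
      linarith
    have hσ : 2 * ((b : ℝ) - Δ) * Fintype.card V ≤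
        (a + Δ + (b - Δ)) * (2 * #S + d x₁ + d x₂) := by
      have h := hdeg x₁ x₂ (fun h => hx₂n (Or.inl h.symm)) fun h => hx₂n (Or.inr h)
      have hab : (a : ℝ) + Δ + (b - Δ) = a + b := by ring
      rw [ge_iff_le, div_le_iff₀ (by linarith)] at h
      rw [hab, mul_comm ((a : ℝ) + b)]
      refine h.trans (mul_le_mul_of_nonneg_right ?_ (by linarith))
      linarith [hdsR x₁, hdsR x₂]
    rcases le_total (d x₂ : ℝ) (b - Δ) with h2 | h2
    · refine not_violated_of_small_second_degree (p := #N) (by linarith) (by linarith) hmR hD h12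
        h2 hNcard hcard hviol ?_ hnR hσ
      rw [← hNQ, add_sub_cancel_left]
      exact hsplit.trans hsumd
    · refine not_violated_of_large_second_degree (q := #Q) haR hΔR (by linarith) hmR hsmall h2
        ?_ ?_ ?_ hnR hσ
      · have h3 : (b : ℝ) + 1 ≤ #T := by exact_mod_cast hbT
        linarith
      · refine le_trans ?_ ((Finset.sum_le_sum_of_subset_of_nonneg (s := Q)
          (Finset.filter_subset _ T) fun _ _ _ => Nat.cast_nonneg _).trans hloss)
        rw [← nsmul_eq_mul]
        refine Finset.card_nsmul_le_sum _ _ _ fun x hx => ?_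
        have h3 : (d' x : ℝ) + 1 ≤ b - Δ := by
          exact_mod_cast hTd' x (Finset.mem_filter.1 hx).1
        have h4 : (d x₂ : ℝ) ≤ d x := by exact_mod_cast hx₂ x hx
        linarith [hdlR x]
      · have h3 : ((b : ℝ) - Δ) * #T = (b - Δ) * #N + (b - Δ) * #Q := by rw [← hNQ]; ring
        have h4 : 0 ≤ ((d x₂ : ℝ) - (b - Δ)) * #Q :=
          mul_nonneg (by linarith) (Nat.cast_nonneg _)
        have h5 := mul_le_mul_of_nonneg_left hNcard (by linarith : (0 : ℝ) ≤ b - Δ - d x₁)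
        linarith
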